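/- Let A* be an (n+1)×(n+1) permutation matrix and B* an (m+1)×(m+1) permutation matrix. Then for all complex (n+1)×(n+1) matrices A, all (m+1)×(m+1) matrices B, and all complex matrices ρ and M indexed by (Fin(n+1) × Fin(m+1)) × (Fin(n+1) × Fin(m+1)): tr((A*A ⊗ B*B) ρ (A*A ⊗ B*B)^T (A* ⊗ B*) M (A* ⊗ B*)^T) = tr((A ⊗ B) ρ (A ⊗ B)^T M), where ⊗ denotes the Kronecker product. -/

import Mathlib

open Matrix Kronecker

/-- The permutation matrix `A_π`, with `A_π |i⟩ = |π i⟩`. -/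
def permMatrix {k : ℕ} (π : Equiv.Perm (Fin k)) : Matrix (Fin k) (Fin k) ℂ :=
  Matrix.of fun i j => if i = π j then 1 else 0

theorem transpose_permMatrix_mul_self {k : ℕ} (π : Equiv.Perm (Fin k)) :
    (permMatrix π)ᵀ * permMatrix π = 1 := by
  ext i j
  simp [permMatrix, Matrix.mul_apply, Matrix.one_apply, eq_comm]

/-- The trace of a product is invariant under simultaneous conjugation by a matrix `P` with
`Pᵀ * P = 1`. -/
theorem trace_conj_mul_conj_of_transpose_mul_self {ι R : Type*} [Fintype ι] [DecidableEq ι]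
    [CommSemiring R] {P : Matrix ι ι R} (hP : Pᵀ * P = 1) (X Y : Matrix ι ι R) :
    Matrix.trace (P * X * Pᵀ * (P * Y * Pᵀ)) = Matrix.trace (X * Y) := by
  calc Matrix.trace (P * X * Pᵀ * (P * Y * Pᵀ))
      = Matrix.trace (P * (X * (Pᵀ * P) * Y) * Pᵀ) := by simp only [Matrix.mul_assoc]
    _ = Matrix.trace (X * Y) := by
        rw [Matrix.trace_mul_comm, ← Matrix.mul_assoc, hP, Matrix.one_mul, Matrix.mul_one]

/-- For permutation matrices `A*` and `B*` and arbitrary complex matrices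
`A`, `B`, `ρ`, `M` of the appropriate sizes,
`tr((A*A ⊗ B*B) ρ (A*A ⊗ B*B)ᵀ (A* ⊗ B*) M (A* ⊗ B*)ᵀ) = tr((A ⊗ B) ρ (A ⊗ B)ᵀ M)`. -/
theorem trace_conj_perm_kronecker {n m : ℕ}
    (πs : Equiv.Perm (Fin (n + 1))) (σs : Equiv.Perm (Fin (m + 1)))
    (Astar : Matrix (Fin (n + 1)) (Fin (n + 1)) ℂ)
    (Bstar : Matrix (Fin (m + 1)) (Fin (m + 1)) ℂ)
    (hA : Astar = permMatrix πs) (hB : Bstar = permMatrix σs)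
    (A : Matrix (Fin (n + 1)) (Fin (n + 1)) ℂ)
    (B : Matrix (Fin (m + 1)) (Fin (m + 1)) ℂ)
    (ρ M : Matrix (Fin (n + 1) × Fin (m + 1)) (Fin (n + 1) × Fin (m + 1)) ℂ) :
    Matrix.trace (((Astar * A) ⊗ₖ (Bstar * B)) * ρ * ((Astar * A) ⊗ₖ (Bstar * B))ᵀ *
        ((Astar ⊗ₖ Bstar) * M * (Astar ⊗ₖ Bstar)ᵀ)) =
      Matrix.trace ((A ⊗ₖ B) * ρ * (A ⊗ₖ B)ᵀ * M) := by
  have hP : (Astar ⊗ₖ Bstar)ᵀ * (Astar ⊗ₖ Bstar) = 1 := by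
    rw [← Matrix.kroneckerMap_transpose, ← Matrix.mul_kronecker_mul, hA, hB,
      transpose_permMatrix_mul_self, transpose_permMatrix_mul_self, Matrix.one_kronecker_one]
  rw [← trace_conj_mul_conj_of_transpose_mul_self hP ((A ⊗ₖ B) * ρ * (A ⊗ₖ B)ᵀ) M,
    Matrix.mul_kronecker_mul, Matrix.transpose_mul]
  simp only [Matrix.mul_assoc]
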